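/- Fix ℏ > 0 and an integer N ≥ 1. For all x, p ∈ ℝ, σ_{H_N}^ℏ(x,p) = 4p e^{−(p²+x²)/ℏ} Σ_{j=0}^{N−2} (−1)^j L_j^{(1)}(2(p²+x²)/ℏ), where L_j^{(1)} is the associated Laguerre polynomial of degree j with parameter 1. -/

import Mathlib

open MeasureTheory Filter

/-- Physicists' Hermite polynomial `h_k(y) = (-1)^k e^{y^2} (d/dy)^k e^{-y^2}`. -/
noncomputable def hermiteH (k : ℕ) (y : ℝ) : ℝ :=
  (-1)^k * Real.exp (y^2) * iteratedDeriv k (fun t => Real.exp (-t^2)) y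

/-- Hermite function `ψ_k^ℏ`. -/
noncomputable def psiH (hbar : ℝ) (k : ℕ) (x : ℝ) : ℝ :=
  (Real.sqrt (Real.sqrt Real.pi * 2^k * (Nat.factorial k) * Real.sqrt hbar))⁻¹ *
    Real.exp (-x^2 / (2*hbar)) * hermiteH k (x / Real.sqrt hbar)

/-- Kernel of the spectral projection `P_{<N}`. -/
noncomputable def KerK (hbar : ℝ) (N : ℕ) (u v : ℝ) : ℝ :=
  ∑ k ∈ Finset.range N, psiH hbar k u * psiH hbar k v

/-- Kernel of the Zeno Hamiltonian `H_N = P_{<N} p̂ P_{<N}`. -/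
noncomputable def KerQ (hbar : ℝ) (N : ℕ) (u v : ℝ) : ℂ :=
  Complex.I * (Real.sqrt (hbar/2) : ℂ) *
    ∑ j ∈ Finset.range (N-1), ((Real.sqrt ((j:ℝ)+1) : ℝ) : ℂ) *
      ((psiH hbar (j+1) u * psiH hbar j v - psiH hbar j u * psiH hbar (j+1) v : ℝ) : ℂ)

/-- Weyl symbol of `P_{<N}`. -/
noncomputable def sigmaP (hbar : ℝ) (N : ℕ) (x p : ℝ) : ℂ :=
  ∫ y : ℝ, ((hbar * KerK hbar N (x - hbar*y/2) (x + hbar*y/2) : ℝ) : ℂ) *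
    Complex.exp (Complex.I * (p:ℂ) * (y:ℂ))

/-- Weyl symbol of `H_N`. -/
noncomputable def sigmaH (hbar : ℝ) (N : ℕ) (x p : ℝ) : ℂ :=
  ∫ y : ℝ, (hbar : ℂ) * KerQ hbar N (x - hbar*y/2) (x + hbar*y/2) *
    Complex.exp (Complex.I * (p:ℂ) * (y:ℂ))

/-- Associated Laguerre polynomial
`L_k^{(j)}(y) = Σ_{m=0}^k ((k+j)!/((k-m)!(j+m)!m!)) (-y)^m`. -/
noncomputable def laguerreL (j k : ℕ) (y : ℝ) : ℝ :=
  ∑ m ∈ Finset.range (k+1),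
    ((Nat.factorial (k+j) : ℝ) /
      ((Nat.factorial (k-m) : ℝ) * (Nat.factorial (j+m) : ℝ) * (Nat.factorial m : ℝ))) * (-y)^m

open Polynomial in
noncomputable def HpR : ℕ → Polynomial ℝ
  | 0 => 1
  | (n+1) => 2 * X * HpR n - derivative (HpR n)

lemma hermite_iter (k : ℕ) :
    iteratedDeriv k (fun t : ℝ => Real.exp (-t^2)) =
      fun y => (-1)^k * Real.exp (-y^2) * (HpR k).eval y := by
  induction k with
  | zero => funext y; simp [HpR]
  | succ k ih =>
    rw [iteratedDeriv_succ, ih]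
    funext y
    have h1 : HasDerivAt (fun y : ℝ => Real.exp (-y^2)) (Real.exp (-y^2) * (-(2*y))) y := by
      have := ((hasDerivAt_pow 2 y).neg).exp
      simpa using this
    have h2 := ((h1.const_mul ((-1:ℝ)^k)).mul ((HpR k).hasDerivAt y))
    have h3 : deriv (fun y => (-1:ℝ)^k * Real.exp (-y^2) * (HpR k).eval y) y = _ := h2.deriv
    rw [h3]
    simp [HpR]
    ring

lemma hermiteH_eq (k : ℕ) (y : ℝ) : hermiteH k y = (HpR k).eval y := by
  unfold hermiteH
  rw [hermite_iter]
  have h : Real.exp (y^2) * Real.exp (-y^2) = 1 := by rw [← Real.exp_add]; simp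
  have h' : ((-1:ℝ)^k) * (-1)^k = 1 := by rw [← mul_pow]; simp
  calc _ = (((-1:ℝ)^k) * (-1)^k) * (Real.exp (y^2) * Real.exp (-y^2)) * (HpR k).eval y := by ring
    _ = _ := by rw [h, h']; ring

open Polynomial in
noncomputable def HpC (n : ℕ) : Polynomial ℂ := (HpR n).map Complex.ofRealHom

open Polynomial in
lemma HpC_zero : HpC 0 = 1 := by simp [HpC, HpR]

open Polynomial in
lemma HpC_succ (n : ℕ) : HpC (n+1) = 2 * X * HpC n - derivative (HpC n) := by
  simp [HpC, HpR, derivative_map]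

open Polynomial in
lemma HpC_deriv (n : ℕ) : derivative (HpC n) = 2 * (n : ℂ[X]) * HpC (n-1) := by
  induction n with
  | zero => simp [HpC_zero]
  | succ n ih =>
    rw [HpC_succ]
    rcases n with _ | n
    · simp [HpC_zero]
    · have h2 := HpC_succ n
      rw [ih]
      simp only [derivative_sub, derivative_mul, derivative_X, derivative_ofNat, derivative_natCast,
        Nat.add_sub_cancel, ih] at *
      rw [h2]
      push_cast
      ring

lemma HpC_eval (n : ℕ) (y : ℝ) : (HpC n).eval (y:ℂ) = (hermiteH n y : ℂ) := by
  rw [hermiteH_eq, HpC]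
  exact Polynomial.eval_map_apply (f := Complex.ofRealHom) y

noncomputable def gau (P s : ℝ) : ℂ := Complex.exp (-(s:ℂ)^2 + 2 * Complex.I * P * s)

lemma norm_gau (P s : ℝ) : ‖gau P s‖ = Real.exp (-s^2) := by
  rw [gau, Complex.norm_exp]
  congr 1
  simp [← Complex.ofReal_pow]

lemma gau_cont (P : ℝ) : Continuous (gau P) := by unfold gau; fun_prop

lemma gau_int (P : ℝ) (q : Polynomial ℂ) :
    Integrable (fun s : ℝ => q.eval (s:ℂ) * gau P s) := by
  induction q using Polynomial.induction_on' with
  | add p q hp hq =>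
    simp only [Polynomial.eval_add, add_mul]
    exact hp.add hq
  | monomial n a =>
    have h := (integrable_rpow_mul_exp_neg_mul_sq (b := 1) one_pos (s := n)
      (by have : (0:ℝ) ≤ n := Nat.cast_nonneg n
          linarith)).norm.const_mul ‖a‖
    refine h.mono' ?_ ?_
    · have := gau_cont P
      exact Continuous.aestronglyMeasurable (by fun_prop)
    · refine Filter.Eventually.of_forall fun s => ?_
      simp [norm_gau, mul_assoc]

noncomputable def Phi (P : ℝ) (q : Polynomial ℂ) : ℂ := ∫ s : ℝ, q.eval (s:ℂ) * gau P s

lemma Phi_add (P : ℝ) (p q : Polynomial ℂ) : Phi P (p + q) = Phi P p + Phi P q := by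
  unfold Phi
  rw [← integral_add (gau_int P p) (gau_int P q)]
  simp [add_mul]

lemma Phi_smul (P : ℝ) (c : ℂ) (q : Polynomial ℂ) :
    Phi P (Polynomial.C c * q) = c * Phi P q := by
  unfold Phi
  rw [← integral_const_mul]
  simp [mul_assoc]

open Polynomial in
lemma Phi_parts (P : ℝ) (q : Polynomial ℂ) :
    Phi P (derivative q + C (-2) * (X * q) + C (2 * Complex.I * P) * q) = 0 := by
  unfold Phi
  refine integral_eq_zero_of_hasDerivAt_of_integrable
    (f := fun s : ℝ => q.eval (s:ℂ) * gau P s) (fun s => ?_) (gau_int P _) (gau_int P _)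
  have h1 : HasDerivAt (fun z : ℂ => q.eval z * Complex.exp (-z^2 + 2 * Complex.I * P * z))
      ((derivative q).eval (s:ℂ) * Complex.exp (-(s:ℂ)^2 + 2 * Complex.I * P * s)
        + q.eval (s:ℂ) * (Complex.exp (-(s:ℂ)^2 + 2 * Complex.I * P * s) *
          (-(2 * (s:ℂ)) + 2 * Complex.I * P))) (s:ℂ) := by
    refine (q.hasDerivAt _).mul (HasDerivAt.cexp ?_)
    have ha := (hasDerivAt_pow 2 (s:ℂ)).neg.add ((hasDerivAt_id (s:ℂ)).const_mul (2 * Complex.I * P))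
    refine (ha.congr_deriv (by simp)).congr_of_eventuallyEq (Filter.Eventually.of_forall fun z => ?_)
    simp
  have h2 := h1.comp_ofReal
  refine h2.congr_deriv ?_
  simp [gau]
  ring

lemma Phi_one (P : ℝ) : Phi P 1 = (Real.sqrt Real.pi : ℂ) * Complex.exp (-(P:ℂ)^2) := by
  unfold Phi gau
  have h := fourierIntegral_gaussian (b := 1) (by simp) (2 * P : ℂ)
  have e : ((Real.pi:ℂ) / 1) ^ (1/2:ℂ) = (Real.sqrt Real.pi : ℂ) := by
    rw [Real.sqrt_eq_rpow, Complex.ofReal_cpow Real.pi_pos.le]; simp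
  rw [e] at h
  convert h using 2
  · funext s
    rw [← Complex.exp_add]
    simp
    ring_nf
  · ring_nf

open Polynomial in
noncomputable def qq (x : ℂ) (m n : ℕ) : Polynomial ℂ :=
  (HpC m).comp (C x - X) * (HpC n).comp (C x + X)

noncomputable def II (x P : ℝ) (m n : ℕ) : ℂ := Phi P (qq x m n)

open Polynomial in
lemma II_succ_right (x P : ℝ) (m n : ℕ) :
    II x P m (n+1) = (2 * (x + Complex.I * P)) * II x P m n - 2 * m * II x P (m-1) n := by
  have h := Phi_parts P (qq x m n)
  have e : qq x m (n+1) = C (2 * (x + Complex.I * P)) * qq x m n + C (-(2 * (m:ℂ))) * qq x (m-1) n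
      + C (-1) * (derivative (qq x m n) + C (-2) * (X * qq x m n) + C (2 * Complex.I * P) * qq x m n) := by
    have hm := HpC_deriv m
    simp only [qq, HpC_succ, derivative_mul, derivative_comp, hm]
    have h2 : (C (2:ℂ) : ℂ[X]) = 2 := rfl
    simp [h2]
    ring
  unfold II
  rw [e, Phi_add, Phi_add, Phi_smul, Phi_smul, Phi_smul, h]
  ring

open Polynomial in
lemma II_succ_left (x P : ℝ) (m n : ℕ) :
    II x P (m+1) n = (2 * (x - Complex.I * P)) * II x P m n - 2 * n * II x P m (n-1) := by
  have h := Phi_parts P (qq x m n)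
  have e : qq x (m+1) n = C (2 * (x - Complex.I * P)) * qq x m n + C (-(2 * (n:ℂ))) * qq x m (n-1)
      + C 1 * (derivative (qq x m n) + C (-2) * (X * qq x m n) + C (2 * Complex.I * P) * qq x m n) := by
    have hm := HpC_deriv n
    simp only [qq, HpC_succ, derivative_mul, derivative_comp, hm]
    have h2 : (C (2:ℂ) : ℂ[X]) = 2 := rfl
    simp [h2]
    ring
  unfold II
  rw [e, Phi_add, Phi_add, Phi_smul, Phi_smul, Phi_smul, h]
  ring

lemma rec_solve (F : ℕ → ℕ → ℂ) (a b : ℂ) (h0 : ∀ m, F (m+1) 0 = a * F m 0)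
    (h1 : ∀ m n, F m (n+1) = b * F m n - 2 * m * F (m-1) n) (n : ℕ) :
    ∀ m, F m n = F 0 0 * ∑ kl ∈ Finset.HasAntidiagonal.antidiagonal n,
      (n.choose kl.1 : ℂ) * ((-2)^kl.1 * (m.descFactorial kl.1 : ℂ) * a^(m-kl.1) * b^kl.2) := by
  induction n with
  | zero =>
    intro m
    induction m with
    | zero => simp
    | succ m ih => rw [h0, ih]; simp; ring
  | succ n ih =>
    intro m
    rw [h1, ih, ih, Finset.sum_antidiagonal_choose_succ_mul
      (fun k l => (-2:ℂ)^k * (m.descFactorial k : ℂ) * a^(m-k) * b^l)]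
    rw [mul_add, Finset.mul_sum, Finset.mul_sum, Finset.mul_sum, Finset.mul_sum, Finset.mul_sum,
      Finset.mul_sum, sub_eq_add_neg, ← Finset.sum_neg_distrib]
    congr 1
    · refine Finset.sum_congr rfl fun kl _ => ?_
      ring
    · refine Finset.sum_congr rfl fun kl hkl => ?_
      have hc : (n.choose kl.2) = n.choose kl.1 := by
        rw [← Finset.HasAntidiagonal.mem_antidiagonal.1 hkl]; exact (Nat.choose_symm_add).symm
      rcases m with _ | m
      · simp
      · rw [Nat.succ_descFactorial_succ]
        simp [hc, -Nat.descFactorial_succ]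
        ring

lemma rec_lag (F : ℕ → ℕ → ℂ) (a b : ℂ) (r : ℝ) (hr : a * b = 2 * r) (h0 : ∀ m, F (m+1) 0 = a * F m 0)
    (h1 : ∀ m n, F m (n+1) = b * F m n - 2 * m * F (m-1) n) (j : ℕ) :
    F (j+1) j = F 0 0 * (a * (-2)^j * (Nat.factorial j : ℂ) * (laguerreL 1 j r : ℂ)) := by
  rw [rec_solve F a b h0 h1 j (j+1)]
  congr 1
  rw [← Finset.Nat.sum_antidiagonal_swap, Finset.Nat.sum_antidiagonal_eq_sum_range_succ_mk]
  unfold laguerreL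
  push_cast
  rw [Finset.mul_sum]
  refine Finset.sum_congr rfl fun m hm => ?_
  have hm' : m ≤ j := by simpa [Nat.lt_succ_iff] using hm
  obtain ⟨d, rfl⟩ := Nat.exists_eq_add_of_le hm'
  have e1 : m + d - m = d := by omega
  have e2 : m + d + 1 - d = m + 1 := by omega
  simp only [Prod.swap_prod_mk, e1, e2]
  have hd : (((m+d+1).descFactorial d : ℕ) : ℂ) * (Nat.factorial (1+m) : ℂ) = (Nat.factorial (m+d+1) : ℂ) := by
    have := Nat.factorial_mul_descFactorial (n := m+d+1) (k := d) (by omega)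
    rw [e2, add_comm m 1] at this
    rw [← this]; push_cast; ring
  have hcz : (((m+d).choose d : ℕ) : ℂ) * (Nat.factorial d : ℂ) * (Nat.factorial m : ℂ) = (Nat.factorial (m+d) : ℂ) := by
    have := Nat.add_choose_mul_factorial_mul_factorial d m
    rw [add_comm d m] at this
    rw [← this, Nat.choose_symm_add]; push_cast; ring
  have n1 : (Nat.factorial (1+m) : ℂ) ≠ 0 := by exact_mod_cast Nat.factorial_ne_zero _
  have n2 : (Nat.factorial d : ℂ) ≠ 0 := by exact_mod_cast Nat.factorial_ne_zero _
  have n3 : (Nat.factorial m : ℂ) ≠ 0 := by exact_mod_cast Nat.factorial_ne_zero _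
  have e3 : (-2:ℂ)^(m+d) * (-(r:ℂ))^m = (-2)^d * (a^m * b^m) := by
    rw [← mul_pow, hr, pow_add, mul_comm ((-2:ℂ)^m), mul_assoc, ← mul_pow]; ring_nf
  rw [← hd, ← hcz]
  field_simp
  rw [pow_succ]
  linear_combination (-((m+d).choose d : ℂ) * ((m+d+1).descFactorial d : ℂ)) * a * e3

lemma II_left (x P : ℝ) (j : ℕ) :
    II x P (j+1) j = II x P 0 0 * ((2 * (x - Complex.I * P)) * (-2)^j * (Nat.factorial j : ℂ) *
      (laguerreL 1 j (2 * (P^2 + x^2)) : ℂ)) := by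
  refine rec_lag (II x P) _ (2 * (x + Complex.I * P)) _ ?_ (fun m => ?_) (fun m n => ?_) j
  · push_cast
    linear_combination (-4 * (P:ℂ)^2) * Complex.I_sq
  · rw [II_succ_left]; simp
  · rw [II_succ_right]

lemma II_right (x P : ℝ) (j : ℕ) :
    II x P j (j+1) = II x P 0 0 * ((2 * (x + Complex.I * P)) * (-2)^j * (Nat.factorial j : ℂ) *
      (laguerreL 1 j (2 * (P^2 + x^2)) : ℂ)) := by
  refine rec_lag (fun m n => II x P n m) _ (2 * (x - Complex.I * P)) _ ?_ (fun m => ?_)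
    (fun m n => ?_) j
  · push_cast
    linear_combination (-4 * (P:ℂ)^2) * Complex.I_sq
  · rw [II_succ_right]; simp
  · rw [II_succ_left]

lemma II_zero (x P : ℝ) : II x P 0 0 = (Real.sqrt Real.pi : ℂ) * Complex.exp (-(P:ℂ)^2) := by
  rw [← Phi_one]; simp [II, qq, HpC_zero]

noncomputable def cN (hbar : ℝ) (k : ℕ) : ℝ :=
  (Real.sqrt (Real.sqrt Real.pi * 2^k * (Nat.factorial k) * Real.sqrt hbar))⁻¹

lemma cN_mul (hbar : ℝ) (hh : 0 < hbar) (j : ℕ) :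
    Real.sqrt (hbar/2) * Real.sqrt ((j:ℝ)+1) * (cN hbar (j+1) * cN hbar j) =
      (2 * Real.sqrt Real.pi * 2^j * (Nat.factorial j))⁻¹ := by
  unfold cN
  have hf : (0:ℝ) < (Nat.factorial j : ℝ) := by exact_mod_cast Nat.factorial_pos j
  have hp := Real.sqrt_pos.2 Real.pi_pos
  have hw := Real.sqrt_pos.2 hh
  have hj : (0:ℝ) < (j:ℝ) + 1 := by positivity
  have hj' := Real.sqrt_pos.2 hj
  set A := Real.sqrt Real.pi * 2^j * (Nat.factorial j) * Real.sqrt hbar with hA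
  have hA0 : 0 < A := by positivity
  have e : Real.sqrt Real.pi * 2^(j+1) * (Nat.factorial (j+1)) * Real.sqrt hbar
      = 2 * (((j:ℝ)+1) * A) := by
    rw [Nat.factorial_succ, hA]; push_cast; ring
  rw [e, Real.sqrt_mul (by norm_num), Real.sqrt_mul hj.le, Real.sqrt_div hh.le]
  have h2 : Real.sqrt 2 * Real.sqrt 2 = 2 := Real.mul_self_sqrt (by norm_num)
  have hAA : Real.sqrt A * Real.sqrt A = A := Real.mul_self_sqrt hA0.le
  have hs2 : 0 < Real.sqrt 2 := by positivity
  have hsA := Real.sqrt_pos.2 hA0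
  calc _ = Real.sqrt hbar / ((Real.sqrt 2 * Real.sqrt 2) * (Real.sqrt A * Real.sqrt A)) := by
        field_simp
    _ = _ := by
        rw [h2, hAA, hA]
        field_simp

lemma psi_prod (hbar : ℝ) (hh : 0 < hbar) (m n : ℕ) (x y p : ℝ) :
    ((psiH hbar m (x - hbar*y/2) * psiH hbar n (x + hbar*y/2) : ℝ) : ℂ) *
      Complex.exp (Complex.I * (p:ℂ) * (y:ℂ)) =
    ((cN hbar m * cN hbar n * Real.exp (-x^2/hbar) : ℝ) : ℂ) *
      ((qq (x / Real.sqrt hbar : ℝ) m n).eval ((Real.sqrt hbar / 2 * y : ℝ) : ℂ) *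
        gau (p / Real.sqrt hbar) (Real.sqrt hbar / 2 * y)) := by
  have hw := Real.sqrt_pos.2 hh
  have hw2 : Real.sqrt hbar * Real.sqrt hbar = hbar := Real.mul_self_sqrt hh.le
  unfold psiH
  rw [← cN, ← cN]
  set w := Real.sqrt hbar with hwdef
  have e1 : (x - hbar*y/2) / w = x / w - w / 2 * y := by rw [← hw2]; field_simp
  have e2 : (x + hbar*y/2) / w = x / w + w / 2 * y := by rw [← hw2]; field_simp
  have e3 : (qq (x / w : ℝ) m n).eval ((w / 2 * y : ℝ) : ℂ) =
      (hermiteH m (x / w - w / 2 * y) : ℂ) * (hermiteH n (x / w + w / 2 * y) : ℂ) := by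
    rw [← HpC_eval, ← HpC_eval]
    simp [qq]
  have e4 : Real.exp (-(x - hbar*y/2)^2/(2*hbar)) * Real.exp (-(x + hbar*y/2)^2/(2*hbar)) =
      Real.exp (-x^2/hbar) * Real.exp (-(w/2*y)^2) := by
    rw [← Real.exp_add, ← Real.exp_add]
    congr 1
    rw [← hw2]
    field_simp
    ring
  have e5 : gau (p / w) (w / 2 * y) = (Real.exp (-(w/2*y)^2) : ℂ) *
      Complex.exp (Complex.I * (p:ℂ) * (y:ℂ)) := by
    have : (w:ℂ) ≠ 0 := by exact_mod_cast hw.ne'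
    rw [gau, Complex.exp_add]
    push_cast
    congr 2
    field_simp
  rw [e1, e2, e3, e5]
  have e4' := congrArg (fun r : ℝ => (r:ℂ)) e4
  simp only [Complex.ofReal_mul] at e4' ⊢
  linear_combination ((cN hbar m : ℂ) * cN hbar n * (hermiteH m (x / w - w / 2 * y) : ℂ) *
    (hermiteH n (x / w + w / 2 * y) : ℂ) * Complex.exp (Complex.I * (p:ℂ) * (y:ℂ))) * e4'

/-- Laguerre-polynomial representation of the Weyl symbol of the Zeno Hamiltonian:
`σ_{H_N}^ℏ(x,p) = 4p e^{-(p²+x²)/ℏ} Σ_{j=0}^{N-2} (-1)^j L_j^{(1)}(2(p²+x²)/ℏ)`. -/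
theorem sigmaH_laguerre (hbar : ℝ) (hh : 0 < hbar) (N : ℕ) (hN : 1 ≤ N) (x p : ℝ) :
    sigmaH hbar N x p =
      ((4 * p * Real.exp (-(p^2+x^2)/hbar) *
        ∑ j ∈ Finset.range (N-1), (-1:ℝ)^j * laguerreL 1 j (2*(p^2+x^2)/hbar) : ℝ) : ℂ) := by
  have hw := Real.sqrt_pos.2 hh
  have hw2 : Real.sqrt hbar * Real.sqrt hbar = hbar := Real.mul_self_sqrt hh.le
  set X := x / Real.sqrt hbar with hX
  set P := p / Real.sqrt hbar with hP
  have hsum : ∀ y : ℝ, (hbar : ℂ) * KerQ hbar N (x - hbar*y/2) (x + hbar*y/2) *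
      Complex.exp (Complex.I * (p:ℂ) * (y:ℂ)) =
      (fun s : ℝ => (∑ j ∈ Finset.range (N-1),
        Polynomial.C (Complex.I * ((hbar * (Real.sqrt (hbar/2) * Real.sqrt ((j:ℝ)+1) *
          (cN hbar (j+1) * cN hbar j)) * Real.exp (-x^2/hbar) : ℝ) : ℂ)) *
          (qq X (j+1) j + Polynomial.C (-1) * qq X j (j+1))).eval (s:ℂ) * gau P s)
        (Real.sqrt hbar / 2 * y) := by
    intro y
    simp only [KerQ, Polynomial.eval_finsetSum, Finset.mul_sum, Finset.sum_mul]
    refine Finset.sum_congr rfl fun j _ => ?_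
    have ha := psi_prod hbar hh (j+1) j x y p
    have hb := psi_prod hbar hh j (j+1) x y p
    rw [← hX, ← hP] at ha hb
    simp only [Polynomial.eval_mul, Polynomial.eval_add, Polynomial.eval_C,
      Complex.ofReal_mul, Complex.ofReal_sub] at ha hb ⊢
    linear_combination ((hbar:ℂ) * Complex.I * (Real.sqrt (hbar/2) : ℂ) *
      (Real.sqrt ((j:ℝ)+1) : ℂ)) * (ha - hb)
  unfold sigmaH
  rw [(integral_congr_ae (Filter.Eventually.of_forall hsum)).trans
    (Measure.integral_comp_mul_left (fun s : ℝ => (∑ j ∈ Finset.range (N-1),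
        Polynomial.C (Complex.I * ((hbar * (Real.sqrt (hbar/2) * Real.sqrt ((j:ℝ)+1) *
          (cN hbar (j+1) * cN hbar j)) * Real.exp (-x^2/hbar) : ℝ) : ℂ)) *
          (qq X (j+1) j + Polynomial.C (-1) * qq X j (j+1))).eval (s:ℂ) * gau P s)
      (Real.sqrt hbar / 2))]
  have hPhi : ∀ (M : ℕ) (f : ℕ → Polynomial ℂ), Phi P (∑ j ∈ Finset.range M, f j) =
      ∑ j ∈ Finset.range M, Phi P (f j) := by
    intro M f
    induction M with
    | zero => simp [Phi]
    | succ M ih => rw [Finset.sum_range_succ, Finset.sum_range_succ, Phi_add, ih]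
  rw [← Phi, hPhi, Finset.mul_sum]
  rw [abs_of_pos (by positivity), Finset.smul_sum]
  push_cast
  refine Finset.sum_congr rfl fun j _ => ?_
  have hl := II_left X P j
  have hr := II_right X P j
  rw [II] at hl hr
  have hcN := congrArg (fun r : ℝ => (r:ℂ)) (cN_mul hbar hh j)
  push_cast at hcN
  rw [Phi_smul, Phi_add, Phi_smul, hl, hr, II_zero, hcN]
  have hpx : 2 * (P^2 + X^2) = 2 * (p^2+x^2)/hbar := by
    rw [hX, hP, div_pow, div_pow, Real.sq_sqrt hh.le]; ring
  have hexp : Complex.exp (-((p:ℂ)^2 + (x:ℂ)^2)/hbar) =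
      Complex.exp (-(x:ℂ)^2/hbar) * Complex.exp (-(P:ℂ)^2) := by
    rw [← Complex.exp_add]
    congr 1
    rw [← Complex.ofReal_pow P, hP, div_pow, Real.sq_sqrt hh.le]
    push_cast
    ring
  have hpP : (p:ℂ) = P * (Real.sqrt hbar : ℂ) := by
    rw [← Complex.ofReal_mul, hP, div_mul_cancel₀ _ hw.ne']
  have hb : (hbar:ℂ) = (Real.sqrt hbar : ℂ) * (Real.sqrt hbar : ℂ) := by
    rw [← Complex.ofReal_mul, hw2]
  rw [hpx, hexp, Complex.real_smul]
  push_cast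
  generalize Complex.exp (-(x:ℂ)^2/hbar) = E1
  generalize Complex.exp (-(P:ℂ)^2) = E2
  generalize (laguerreL 1 j (2 * (p^2+x^2)/hbar) : ℂ) = L
  rw [hpP]
  have hwc : (Real.sqrt hbar : ℂ) ≠ 0 := by exact_mod_cast hw.ne'
  have hpi : (Real.sqrt Real.pi : ℂ) ≠ 0 := by
    exact_mod_cast (Real.sqrt_pos.2 Real.pi_pos).ne'
  have hf : (Nat.factorial j : ℂ) ≠ 0 := by exact_mod_cast Nat.factorial_ne_zero _
  have h2j : (-2:ℂ)^j = (-1)^j * 2^j := by rw [← mul_pow]; norm_num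
  rw [h2j]
  have hbE : ∀ z : ℂ, (hbar:ℂ) * z = (Real.sqrt hbar : ℂ) * (Real.sqrt hbar : ℂ) * z := by
    intro z; rw [← hb]
  simp only [hbE]
  field_simp
  linear_combination (-4 * (P:ℂ) * E1 * E2 * L) * Complex.I_sq
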